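/- arXiv:2106.05188 — 3 statements merged into one kernel-verified Lean document; each statement's English description precedes it below -/
import Mathlib

section
/- Let k ≥ 1 and let e, ê : Fin k → ℝ be entry times of two contiguous schedules with the same durations d : Fin k → ℝ and the same time-past-a-point constant tpp (so (e i + d i) − e (i+1) = tpp and (ê i + d i) − ê (i+1) = tpp whenever i+1 < k). If ê i ≥ e i for every i (proposals can only delay requests) and ê 0 = e 0, then ê = e; that is, a consistent proposed plan must exactly match the requested plan. -/
/-- Lemma 3: a consistent proposed plan, whose entry times can only be
delayed with respect to the requested plan and which starts at the same time, must
exactly match the requested plan. -/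
theorem consistent_proposal_eq_request (k : ℕ) (hk : 1 ≤ k)
    (e eP d : Fin k → ℝ) (tpp : ℝ)
    (he : ∀ (i : Fin k) (h : i.val + 1 < k), (e i + d i) - e ⟨i.val + 1, h⟩ = tpp)
    (heP : ∀ (i : Fin k) (h : i.val + 1 < k), (eP i + d i) - eP ⟨i.val + 1, h⟩ = tpp)
    (hdelay : ∀ i : Fin k, eP i ≥ e i)
    (h0 : eP ⟨0, hk⟩ = e ⟨0, hk⟩) :
    eP = e := by
  funext ⟨n, hn⟩
  induction n with
  | zero => exact h0
  | succ n ih =>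
    have hlt : n < k := Nat.lt_of_succ_lt hn
    linarith [ih hlt, he ⟨n, hlt⟩ hn, heP ⟨n, hlt⟩ hn]
end

section
/- Let n ≥ 1, let t : Fin n → ℝ be requested entry times, d : Fin n → ℝ durations with d i ≥ 0 for all i, and t_min ≥ 0 a minimal separation time. Define the greedy allocation s : Fin n → ℝ by s 0 = t 0 and s (i+1) = max (t (i+1)) (s i + d i + t_min). If u : Fin n → ℝ is any allocation satisfying u i ≥ t i for all i and u (i+1) ≥ u i + d i + t_min for all i with i+1 < n, then s i ≤ u i for every i; that is, the greedy allocation assigns every request the earliest possible non-overlapping time-slot. -/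
/-- the greedy allocation is pointwise minimal among all feasible
allocations, i.e. it assigns every request the earliest possible non-overlapping
time-slot. -/
theorem greedy_allocation_minimal (n : ℕ) (hn : 1 ≤ n)
    (t d s : Fin n → ℝ) (tmin : ℝ)
    (hd : ∀ i : Fin n, d i ≥ 0) (htmin : tmin ≥ 0)
    (h0 : s ⟨0, hn⟩ = t ⟨0, hn⟩)
    (hrec : ∀ (i : Fin n) (h : i.val + 1 < n),
      s ⟨i.val + 1, h⟩ = max (t ⟨i.val + 1, h⟩) (s i + d i + tmin))
    (u : Fin n → ℝ)
    (hu1 : ∀ i : Fin n, u i ≥ t i)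
    (hu2 : ∀ (i : Fin n) (h : i.val + 1 < n), u ⟨i.val + 1, h⟩ ≥ u i + d i + tmin) :
    ∀ i : Fin n, s i ≤ u i := by
  rintro ⟨k, hk⟩
  induction k with
  | zero => exact h0.trans_le (hu1 _)
  | succ k ih =>
    have hk' : k < n := Nat.lt_of_succ_lt hk
    have step : u ⟨k + 1, hk⟩ ≥ u ⟨k, hk'⟩ + d ⟨k, hk'⟩ + tmin := hu2 ⟨k, hk'⟩ hk
    calc s ⟨k + 1, hk⟩
        = max (t ⟨k + 1, hk⟩) (s ⟨k, hk'⟩ + d ⟨k, hk'⟩ + tmin) := hrec ⟨k, hk'⟩ hk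
      _ ≤ u ⟨k + 1, hk⟩ := max_le (hu1 _) (by linarith [ih hk'])
end

section
/- Let n ≥ 1, let t : Fin n → ℝ be requested entry times, d : Fin n → ℝ durations, and t_min ∈ ℝ. Define the greedy allocation s : Fin n → ℝ by s 0 = t 0 and s (i+1) = max (t (i+1)) (s i + d i + t_min). Then for every i < n, s i admits the closed form s i = max over j ≤ i of ( t j + ∑_{m=j}^{i−1} (d m + t_min) ). -/
theorem Fin.sum_Ico_mk_succ {M : Type*} [AddCommMonoid M] {n k : ℕ} (h : k + 1 < n)
    (f : Fin n → M) {j : Fin n} (hj : j ≤ ⟨k, Nat.lt_of_succ_lt h⟩) :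
    ∑ m ∈ Finset.Ico j ⟨k + 1, h⟩, f m =
      ∑ m ∈ Finset.Ico j ⟨k, Nat.lt_of_succ_lt h⟩, f m + f ⟨k, Nat.lt_of_succ_lt h⟩ := by
  have hins : Finset.Ico j ⟨k + 1, h⟩ =
      insert ⟨k, Nat.lt_of_succ_lt h⟩ (Finset.Ico j ⟨k, Nat.lt_of_succ_lt h⟩) := by
    ext m
    simp only [Finset.mem_Ico, Finset.mem_insert, Fin.le_def, Fin.lt_def, Fin.ext_iff] at hj ⊢
    omega
  rw [hins, Finset.sum_insert (by simp), add_comm]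

/-- closed form of the greedy allocation:
`s i = max_{j ≤ i} ( t j + ∑_{m=j}^{i-1} (d m + tmin) )`. -/
theorem greedy_allocation_closed_form (n : ℕ) (hn : 1 ≤ n)
    (t d s : Fin n → ℝ) (tmin : ℝ)
    (h0 : s ⟨0, hn⟩ = t ⟨0, hn⟩)
    (hrec : ∀ (i : Fin n) (h : i.val + 1 < n),
      s ⟨i.val + 1, h⟩ = max (t ⟨i.val + 1, h⟩) (s i + d i + tmin)) :
    ∀ i : Fin n,
      s i = (Finset.Iic i).sup' Finset.nonempty_Iic
        (fun j => t j + ∑ m ∈ Finset.Ico j i, (d m + tmin)) := by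
  suffices key : ∀ (k : ℕ) (hk : k < n),
      (∀ j : Fin n, j ≤ ⟨k, hk⟩ →
        t j + ∑ m ∈ Finset.Ico j ⟨k, hk⟩, (d m + tmin) ≤ s ⟨k, hk⟩) ∧
      ∃ j : Fin n, j ≤ ⟨k, hk⟩ ∧
        s ⟨k, hk⟩ = t j + ∑ m ∈ Finset.Ico j ⟨k, hk⟩, (d m + tmin) by
    intro i
    obtain ⟨hle, j, hj, hs⟩ := key i i.isLt
    refine le_antisymm ?_ (Finset.sup'_le _ _ fun j hj => hle j (Finset.mem_Iic.1 hj))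
    exact hs.le.trans (Finset.le_sup'
      (fun j => t j + ∑ m ∈ Finset.Ico j i, (d m + tmin)) (Finset.mem_Iic.2 hj))
  intro k
  induction k with
  | zero =>
    intro hk
    refine ⟨fun j hj => ?_, ⟨0, hk⟩, le_rfl, by simpa using h0⟩
    obtain rfl : j = ⟨0, hk⟩ := Fin.ext (Nat.le_zero.1 hj)
    simpa using h0.ge
  | succ k ih =>
    intro hk
    obtain ⟨hle, j₀, hj₀, hs⟩ := ih (Nat.lt_of_succ_lt hk)
    have hstep := hrec ⟨k, Nat.lt_of_succ_lt hk⟩ hk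
    dsimp only at hstep
    refine ⟨fun j hj => ?_, ?_⟩
    · rw [hstep]
      rcases Nat.le_succ_iff.1 (Fin.le_def.1 hj) with hjk | hjk
      · rw [Fin.sum_Ico_mk_succ hk _ (Fin.le_def.2 hjk)]
        refine le_trans ?_ (le_max_right _ _)
        linarith [hle j (Fin.le_def.2 hjk)]
      · obtain rfl : j = ⟨k + 1, hk⟩ := Fin.ext hjk
        simp
    · rw [hstep]
      rcases max_choice (t ⟨k + 1, hk⟩)
        (s ⟨k, Nat.lt_of_succ_lt hk⟩ + d ⟨k, Nat.lt_of_succ_lt hk⟩ + tmin) with hm | hm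
      · exact ⟨⟨k + 1, hk⟩, le_rfl, by simpa using hm⟩
      · refine ⟨j₀, hj₀.trans (Fin.le_def.2 (Nat.le_succ k)), ?_⟩
        rw [hm, Fin.sum_Ico_mk_succ hk _ hj₀, hs]
        ring
end
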